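/- arXiv:1801.03071 — 2 statements merged into one kernel-verified Lean document; each statement's English description precedes it below -/
import Mathlib

section
/- Seven-qubit eight-term tripartite monogamy: For every 7-qubit density matrix ρ, the xy-plane Bell strengths satisfy 𝒯²₁₂₃(ρ) + 𝒯²₃₄₅(ρ) + 𝒯²₅₆₁(ρ) + 𝒯²₁₃₅(ρ) + 𝒯²₂₄₆(ρ) + 𝒯²₄₆₇(ρ) + 𝒯²₆₇₂(ρ) + 𝒯²₇₂₄(ρ) ≤ 8. -/
open Matrix Complex ComplexOrder

noncomputable section

/-- The Pauli X matrix. -/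
def pX : Matrix (Fin 2) (Fin 2) ℂ := !![0, 1; 1, 0]

/-- The Pauli Y matrix. -/
def pY : Matrix (Fin 2) (Fin 2) ℂ := !![0, -Complex.I; Complex.I, 0]

/-- The Pauli Z matrix. -/
def pZ : Matrix (Fin 2) (Fin 2) ℂ := !![1, 0; 0, -1]

/-- The operator on `n` qubits acting as the single-qubit operator `M` on qubit `i`
and as the identity on all other qubits. -/
def onQubit {n : ℕ} (M : Matrix (Fin 2) (Fin 2) ℂ) (i : Fin n) :
    Matrix (Fin n → Fin 2) (Fin n → Fin 2) ℂ :=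
  Matrix.of fun a b => ∏ s, if s = i then M (a s) (b s) else (if a s = b s then 1 else 0)

/-- An `n`-qubit density matrix: positive semidefinite with unit trace. -/
def IsDensityMatrix {n : ℕ} (ρ : Matrix (Fin n → Fin 2) (Fin n → Fin 2) ℂ) : Prop :=
  ρ.PosSemidef ∧ ρ.trace = 1

/-- The two Pauli matrices spanning the xy plane. -/
def XY : Fin 2 → Matrix (Fin 2) (Fin 2) ℂ := ![pX, pY]

/-- The two Pauli matrices spanning the xz plane. -/
def XZ : Fin 2 → Matrix (Fin 2) (Fin 2) ℂ := ![pX, pZ]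

/-- The xy-plane Bell strength 𝒯²_{ij}(ρ) of the pair of qubits (i,j). -/
def T2pair {n : ℕ} (ρ : Matrix (Fin n → Fin 2) (Fin n → Fin 2) ℂ) (i j : Fin n) : ℝ :=
  ∑ k : Fin 2, ∑ l : Fin 2,
    ((ρ * (onQubit (XY k) i * onQubit (XY l) j)).trace.re) ^ 2

/-- The xy-plane Bell strength 𝒯²_{ijm}(ρ) of the triple of qubits (i,j,m). -/
def T2triple {n : ℕ} (ρ : Matrix (Fin n → Fin 2) (Fin n → Fin 2) ℂ) (i j m : Fin n) : ℝ :=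
  ∑ k : Fin 2, ∑ l : Fin 2, ∑ p : Fin 2,
    ((ρ * (onQubit (XY k) i * onQubit (XY l) j * onQubit (XY p) m)).trace.re) ^ 2

/-- The xy-plane Bell strength 𝒯²_{ijml}(ρ) of the quadruple of qubits (i,j,m,l). -/
def T2quad {n : ℕ} (ρ : Matrix (Fin n → Fin 2) (Fin n → Fin 2) ℂ) (i j m l : Fin n) : ℝ :=
  ∑ k : Fin 2, ∑ k' : Fin 2, ∑ k'' : Fin 2, ∑ k''' : Fin 2,
    ((ρ * (onQubit (XY k) i * onQubit (XY k') j * onQubit (XY k'') m *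
        onQubit (XY k''') l)).trace.re) ^ 2

/-- The xz-plane Bell strength of the pair of qubits (i,j). -/
def T2pairXZ {n : ℕ} (ρ : Matrix (Fin n → Fin 2) (Fin n → Fin 2) ℂ) (i j : Fin n) : ℝ :=
  ∑ k : Fin 2, ∑ l : Fin 2,
    ((ρ * (onQubit (XZ k) i * onQubit (XZ l) j)).trace.re) ^ 2

/-- The tensor product of single-qubit operators. -/
def tensorOp {n : ℕ} (M : Fin n → Matrix (Fin 2) (Fin 2) ℂ) :
    Matrix (Fin n → Fin 2) (Fin n → Fin 2) ℂ :=
  Matrix.of fun a b => ∏ s, M s (a s) (b s)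

lemma tensorOp_mul {n : ℕ} (M N : Fin n → Matrix (Fin 2) (Fin 2) ℂ) :
    tensorOp M * tensorOp N = tensorOp (M * N) := by
  ext a b
  simp only [tensorOp, Matrix.mul_apply, Matrix.of_apply, Pi.mul_apply]
  rw [Fintype.prod_sum]
  simp only [Finset.prod_mul_distrib]

lemma tensorOp_one {n : ℕ} : tensorOp (1 : Fin n → Matrix (Fin 2) (Fin 2) ℂ) = 1 := by
  ext a b
  simp only [tensorOp, Matrix.of_apply, Pi.one_apply, Matrix.one_apply]
  rw [Fintype.prod_ite_zero]
  simp [funext_iff]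

lemma tensorOp_smul {n : ℕ} (c : Fin n → ℂ) (M : Fin n → Matrix (Fin 2) (Fin 2) ℂ) :
    tensorOp (fun s => c s • M s) = (∏ s, c s) • tensorOp M := by
  ext a b
  simp [tensorOp, Finset.prod_mul_distrib]

lemma tensorOp_conjTranspose {n : ℕ} (M : Fin n → Matrix (Fin 2) (Fin 2) ℂ) :
    (tensorOp M)ᴴ = tensorOp (fun s => (M s)ᴴ) := by
  ext a b
  simp [tensorOp, Matrix.conjTranspose_apply]

lemma onQubit_eq_tensorOp {n : ℕ} (M : Matrix (Fin 2) (Fin 2) ℂ) (i : Fin n) :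
    onQubit M i = tensorOp (Pi.mulSingle i M) := by
  ext a b
  simp only [onQubit, tensorOp, Matrix.of_apply]
  refine Finset.prod_congr rfl fun s _ => ?_
  by_cases h : s = i
  · subst h; simp
  · simp [h, Matrix.one_apply]

/-- A letter of a Pauli word: the identity, or one of the two xy-plane Pauli matrices. -/
def pauliLetter : Option (Fin 2) → Matrix (Fin 2) (Fin 2) ℂ
  | none => 1
  | some k => XY k

/-- The commutation sign of two letters. -/
def letterSign : Option (Fin 2) → Option (Fin 2) → ℤ
  | some k, some l => if k = l then 1 else -1
  | _, _ => 1

lemma pauliLetter_mul_comm (a b : Option (Fin 2)) :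
    pauliLetter a * pauliLetter b =
      (letterSign a b : ℂ) • (pauliLetter b * pauliLetter a) := by
  rcases a with _ | k <;> rcases b with _ | l <;> simp only [pauliLetter, letterSign]
  · simp
  · simp
  · simp
  · fin_cases k <;> fin_cases l <;> simp [XY, pX, pY]

lemma pauliLetter_mul_self (a : Option (Fin 2)) : pauliLetter a * pauliLetter a = 1 := by
  rcases a with _ | k
  · simp [pauliLetter]
  · fin_cases k <;> simp [pauliLetter, XY, pX, pY, Matrix.one_fin_two]

lemma pauliLetter_conjTranspose (a : Option (Fin 2)) : (pauliLetter a)ᴴ = pauliLetter a := by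
  rcases a with _ | k
  · simp [pauliLetter]
  · fin_cases k <;> ext i j <;> fin_cases i <;> fin_cases j <;>
      simp [pauliLetter, XY, pX, pY, Matrix.conjTranspose_apply]

/-- The tensor product of the letters of a word. -/
def pauliWord {n : ℕ} (w : Fin n → Option (Fin 2)) :
    Matrix (Fin n → Fin 2) (Fin n → Fin 2) ℂ :=
  tensorOp fun s => pauliLetter (w s)

lemma pauliWord_mul_self {n : ℕ} (w : Fin n → Option (Fin 2)) :
    pauliWord w * pauliWord w = 1 := by
  rw [pauliWord, tensorOp_mul, ← tensorOp_one]
  congr 1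
  funext s
  exact pauliLetter_mul_self _

lemma pauliWord_isHermitian {n : ℕ} (w : Fin n → Option (Fin 2)) :
    (pauliWord w).IsHermitian := by
  rw [Matrix.IsHermitian, pauliWord, tensorOp_conjTranspose]
  simp only [pauliLetter_conjTranspose]

lemma pauliWord_anticomm {n : ℕ} (v w : Fin n → Option (Fin 2))
    (h : ∏ s, letterSign (v s) (w s) = -1) :
    pauliWord v * pauliWord w = -(pauliWord w * pauliWord v) := by
  have hc : ∏ s, ((letterSign (v s) (w s) : ℤ) : ℂ) = -1 := by 
    exact_mod_cast congrArg (Int.cast : ℤ → ℂ) h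
  rw [pauliWord, pauliWord, tensorOp_mul, tensorOp_mul, ← neg_one_smul ℂ, ← hc, ← tensorOp_smul]
  congr 1
  funext s
  exact pauliLetter_mul_comm _ _

/-- **Correlation complementarity**: pairwise anticommuting Hermitian involutions have
expectation values whose squares sum to at most one. -/
lemma sum_sq_trace_le_one_of_anticomm {d ι : Type*} [Fintype d] [DecidableEq d] [Fintype ι]
    {ρ : Matrix d d ℂ} (hρ : ρ.PosSemidef) (htr : ρ.trace = 1) (A : ι → Matrix d d ℂ)
    (hH : ∀ i, (A i).IsHermitian) (hsq : ∀ i, A i * A i = 1)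
    (hanti : ∀ i j, i ≠ j → A i * A j = -(A j * A i)) :
    ∑ i, ((ρ * A i).trace.re) ^ 2 ≤ 1 := by
  classical
  set α : ι → ℝ := fun i => (ρ * A i).trace.re with hα
  set S : Matrix d d ℂ := ∑ i, (α i : ℂ) • A i with hS
  set t : ℝ := ∑ i, α i ^ 2 with ht
  have hSH : Sᴴ = S := by
    rw [hS, Matrix.conjTranspose_sum]
    refine Finset.sum_congr rfl fun i _ => ?_
    rw [Matrix.conjTranspose_smul, (hH i).eq]
    simp
  have hexp : S * S = ∑ i, ∑ j, ((α i : ℂ) * (α j : ℂ)) • (A i * A j) := by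
    simp only [hS, Finset.sum_mul_sum, smul_mul_smul_comm]
  have hSS : S * S = (t : ℂ) • (1 : Matrix d d ℂ) := by
    have h2 : S * S + S * S = (t : ℂ) • (1 : Matrix d d ℂ) + (t : ℂ) • 1 := by
      have hswap : S * S = ∑ i, ∑ j, ((α i : ℂ) * (α j : ℂ)) • (A j * A i) := by
        rw [hexp, Finset.sum_comm]
        simp only [mul_comm]
      nth_rewrite 1 [hexp]
      rw [hswap, ← Finset.sum_add_distrib]
      have hrow : ∀ i, (∑ j, ((α i : ℂ) * (α j : ℂ)) • (A i * A j)) +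
          (∑ j, ((α i : ℂ) * (α j : ℂ)) • (A j * A i)) =
          ((α i : ℂ) ^ 2) • (1 : Matrix d d ℂ) + ((α i : ℂ) ^ 2) • 1 := by
        intro i
        rw [← Finset.sum_add_distrib, Finset.sum_eq_single i]
        · rw [hsq, pow_two]
        · intro j _ hj
          rw [hanti i j hj.symm, smul_neg, neg_add_cancel]
        · simp
      simp only [hrow, Finset.sum_add_distrib, ← Finset.sum_smul, ht]
      push_cast
      rfl
    rw [← two_smul ℂ, ← two_smul ℂ] at h2
    exact smul_right_injective _ (two_ne_zero' ℂ) h2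
  have htS : (ρ * S).trace.re = t := by
    simp only [hS, Finset.mul_sum, Matrix.mul_smul, Matrix.trace_sum, Matrix.trace_smul,
      Complex.re_sum, smul_eq_mul, Complex.re_ofReal_mul, ht, pow_two, hα]
  have hpos : 0 ≤ ((1 - S) * ρ * (1 - S)ᴴ).trace :=
    (hρ.mul_mul_conjTranspose_same (1 - S)).trace_nonneg
  have hval : ((1 - S) * ρ * (1 - S)ᴴ).trace = 1 + (t : ℂ) - 2 * (ρ * S).trace := by
    have hmul : (1 - S) * (1 - S) = 1 + (t : ℂ) • (1 : Matrix d d ℂ) - (2 : ℂ) • S := by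
      rw [← hSS, two_smul]
      noncomm_ring
    rw [Matrix.conjTranspose_sub, Matrix.conjTranspose_one, hSH, Matrix.trace_mul_cycle, hmul,
      Matrix.trace_mul_comm]
    simp [Matrix.mul_sub, Matrix.mul_add, Matrix.trace_sub, Matrix.trace_add, htr]
  rw [hval] at hpos
  have hre := (Complex.le_def.mp hpos).1
  simp [htS] at hre
  linarith

/-- The squared expectation value of a Pauli word. -/
def wordSq {n : ℕ} (ρ : Matrix (Fin n → Fin 2) (Fin n → Fin 2) ℂ) (w : Fin n → Option (Fin 2)) :
    ℝ :=
  ((ρ * pauliWord w).trace.re) ^ 2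

lemma sum_wordSq_le_one {n m : ℕ} {ρ : Matrix (Fin n → Fin 2) (Fin n → Fin 2) ℂ}
    (hρ : IsDensityMatrix ρ) (w : Fin m → Fin n → Option (Fin 2))
    (hw : ∀ i j, i ≠ j → ∏ s, letterSign (w i s) (w j s) = -1) :
    ∑ i, wordSq ρ (w i) ≤ 1 :=
  sum_sq_trace_le_one_of_anticomm hρ.1 hρ.2 (fun i => pauliWord (w i))
    (fun _ => pauliWord_isHermitian _) (fun _ => pauliWord_mul_self _)
    (fun i j hij => pauliWord_anticomm _ _ (hw i j hij))

/-- The word with letters `k`, `l`, `p` at the positions `i`, `j`, `m`. -/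
def tripleWord {n : ℕ} (i j m : Fin n) (k l p : Fin 2) : Fin n → Option (Fin 2) :=
  fun s => if s = i then some k else if s = j then some l else if s = m then some p else none

lemma onQubit_mul_eq_pauliWord {n : ℕ} {i j m : Fin n} (hij : i ≠ j) (him : i ≠ m) (hjm : j ≠ m)
    (k l p : Fin 2) :
    onQubit (XY k) i * onQubit (XY l) j * onQubit (XY p) m =
      pauliWord (tripleWord i j m k l p) := by
  simp only [onQubit_eq_tensorOp, tensorOp_mul, pauliWord]
  congr 1
  funext s
  simp only [Pi.mul_apply, Pi.mulSingle_apply, tripleWord]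
  split_ifs <;> simp_all [pauliLetter]

lemma T2triple_eq_sum_wordSq {n : ℕ} (ρ : Matrix (Fin n → Fin 2) (Fin n → Fin 2) ℂ)
    {i j m : Fin n} (hij : i ≠ j) (him : i ≠ m) (hjm : j ≠ m) :
    T2triple ρ i j m = ∑ k, ∑ l, ∑ p, wordSq ρ (tripleWord i j m k l p) := by
  simp only [T2triple, wordSq, onQubit_mul_eq_pauliWord hij him hjm]

/-- The triples of the triangle `0`, `2`, `4` and its three edges extended by private qubits. -/
lemma ring_T2triple_le_four {ρ : Matrix (Fin 7 → Fin 2) (Fin 7 → Fin 2) ℂ}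
    (hρ : IsDensityMatrix ρ) :
    T2triple ρ 0 1 2 + T2triple ρ 2 3 4 + T2triple ρ 4 5 0 + T2triple ρ 0 2 4 ≤ 4 := by
  have h₁ := sum_wordSq_le_one (m := 8) hρ ![
    tripleWord 0 1 2 0 0 0, tripleWord 0 1 2 0 1 0, tripleWord 2 3 4 1 0 0,
    tripleWord 2 3 4 1 1 0, tripleWord 4 5 0 1 0 1, tripleWord 4 5 0 1 1 1,
    tripleWord 0 2 4 0 1 1, tripleWord 0 2 4 1 0 0]
    (by decide +kernel)
  have h₂ := sum_wordSq_le_one (m := 8) hρ ![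
    tripleWord 0 1 2 0 0 1, tripleWord 0 1 2 0 1 1, tripleWord 2 3 4 0 0 1,
    tripleWord 2 3 4 0 1 1, tripleWord 4 5 0 0 0 1, tripleWord 4 5 0 0 1 1,
    tripleWord 0 2 4 0 0 0, tripleWord 0 2 4 1 1 1]
    (by decide +kernel)
  have h₃ := sum_wordSq_le_one (m := 8) hρ ![
    tripleWord 0 1 2 1 0 0, tripleWord 0 1 2 1 1 0, tripleWord 2 3 4 1 0 1,
    tripleWord 2 3 4 1 1 1, tripleWord 4 5 0 0 0 0, tripleWord 4 5 0 0 1 0,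
    tripleWord 0 2 4 0 0 1, tripleWord 0 2 4 1 1 0]
    (by decide +kernel)
  have h₄ := sum_wordSq_le_one (m := 8) hρ ![
    tripleWord 0 1 2 1 0 1, tripleWord 0 1 2 1 1 1, tripleWord 2 3 4 0 0 0,
    tripleWord 2 3 4 0 1 0, tripleWord 4 5 0 1 0 0, tripleWord 4 5 0 1 1 0,
    tripleWord 0 2 4 0 1 0, tripleWord 0 2 4 1 0 1]
    (by decide +kernel)
  simp only [Fin.sum_univ_eight] at h₁ h₂ h₃ h₄
  rw [T2triple_eq_sum_wordSq ρ (i := 0) (j := 1) (m := 2) (by decide) (by decide) (by decide)]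
  rw [T2triple_eq_sum_wordSq ρ (i := 2) (j := 3) (m := 4) (by decide) (by decide) (by decide)]
  rw [T2triple_eq_sum_wordSq ρ (i := 4) (j := 5) (m := 0) (by decide) (by decide) (by decide)]
  rw [T2triple_eq_sum_wordSq ρ (i := 0) (j := 2) (m := 4) (by decide) (by decide) (by decide)]
  simp only [Fin.sum_univ_two]
  simp at h₁ h₂ h₃ h₄
  linarith

/-- All triples among the qubits `1`, `3`, `5`, `6`. -/
lemma four_qubit_T2triple_le_four {ρ : Matrix (Fin 7 → Fin 2) (Fin 7 → Fin 2) ℂ}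
    (hρ : IsDensityMatrix ρ) :
    T2triple ρ 1 3 5 + T2triple ρ 3 5 6 + T2triple ρ 5 6 1 + T2triple ρ 6 1 3 ≤ 4 := by
  have h₁ := sum_wordSq_le_one (m := 8) hρ ![
    tripleWord 1 3 5 0 0 0, tripleWord 1 3 5 1 1 1, tripleWord 3 5 6 0 1 0,
    tripleWord 3 5 6 1 0 1, tripleWord 5 6 1 0 0 1, tripleWord 5 6 1 1 1 0,
    tripleWord 6 1 3 0 0 1, tripleWord 6 1 3 1 1 0]
    (by decide +kernel)
  have h₂ := sum_wordSq_le_one (m := 8) hρ ![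
    tripleWord 1 3 5 0 0 1, tripleWord 1 3 5 1 1 0, tripleWord 3 5 6 0 0 1,
    tripleWord 3 5 6 1 1 0, tripleWord 5 6 1 0 0 0, tripleWord 5 6 1 1 1 1,
    tripleWord 6 1 3 0 1 0, tripleWord 6 1 3 1 0 1]
    (by decide +kernel)
  have h₃ := sum_wordSq_le_one (m := 8) hρ ![
    tripleWord 1 3 5 0 1 0, tripleWord 1 3 5 1 0 1, tripleWord 3 5 6 0 0 0,
    tripleWord 3 5 6 1 1 1, tripleWord 5 6 1 0 1 1, tripleWord 5 6 1 1 0 0,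
    tripleWord 6 1 3 0 1 1, tripleWord 6 1 3 1 0 0]
    (by decide +kernel)
  have h₄ := sum_wordSq_le_one (m := 8) hρ ![
    tripleWord 1 3 5 0 1 1, tripleWord 1 3 5 1 0 0, tripleWord 3 5 6 0 1 1,
    tripleWord 3 5 6 1 0 0, tripleWord 5 6 1 0 1 0, tripleWord 5 6 1 1 0 1,
    tripleWord 6 1 3 0 0 0, tripleWord 6 1 3 1 1 1]
    (by decide +kernel)
  simp only [Fin.sum_univ_eight] at h₁ h₂ h₃ h₄
  rw [T2triple_eq_sum_wordSq ρ (i := 1) (j := 3) (m := 5) (by decide) (by decide) (by decide)]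
  rw [T2triple_eq_sum_wordSq ρ (i := 3) (j := 5) (m := 6) (by decide) (by decide) (by decide)]
  rw [T2triple_eq_sum_wordSq ρ (i := 5) (j := 6) (m := 1) (by decide) (by decide) (by decide)]
  rw [T2triple_eq_sum_wordSq ρ (i := 6) (j := 1) (m := 3) (by decide) (by decide) (by decide)]
  simp only [Fin.sum_univ_two]
  simp at h₁ h₂ h₃ h₄
  linarith

/-- **Seven-qubit eight-term tripartite monogamy.** For every 7-qubit density matrix,
𝒯²₁₂₃ + 𝒯²₃₄₅ + 𝒯²₅₆₁ + 𝒯²₁₃₅ + 𝒯²₂₄₆ + 𝒯²₄₆₇ + 𝒯²₆₇₂ + 𝒯²₇₂₄ ≤ 8. -/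
theorem seven_qubit_tripartite_monogamy (ρ : Matrix (Fin 7 → Fin 2) (Fin 7 → Fin 2) ℂ)
    (hρ : IsDensityMatrix ρ) :
    T2triple ρ 0 1 2 + T2triple ρ 2 3 4 + T2triple ρ 4 5 0 + T2triple ρ 0 2 4 +
      T2triple ρ 1 3 5 + T2triple ρ 3 5 6 + T2triple ρ 5 6 1 + T2triple ρ 6 1 3 ≤ 8 := by
  linarith [ring_T2triple_le_four hρ, four_qubit_T2triple_le_four hρ]
end
end

section
/- General bipartite Bell monogamy for arbitrary graphs: Let G be a finite simple graph on the vertex set {1,…,n} with edge set E, and for a vertex v let deg(v) denote its degree in G. Then for every n-qubit density matrix ρ, Σ_{e = {u,v} ∈ E} (deg(u) + deg(v) − 2) · 𝒯²_{uv}(ρ) ≤ 2 · Σ_{v=1}^{n} C(deg(v), 2), where C(d,2) = d(d−1)/2. (The coefficient deg(u)+deg(v)−2 is the degree of the edge e in the line graph of G, and Σ_v C(deg(v),2) is the number of edges of the line graph of G.) -/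
open Matrix Complex ComplexOrder

noncomputable section

/-- The tensor product of a family of single-qubit operators. -/
def qubitTensor {n : ℕ} (F : Fin n → Matrix (Fin 2) (Fin 2) ℂ) :
    Matrix (Fin n → Fin 2) (Fin n → Fin 2) ℂ :=
  Matrix.of fun a b => ∏ s, F s (a s) (b s)

lemma qubitTensor_mul {n : ℕ} (F G : Fin n → Matrix (Fin 2) (Fin 2) ℂ) :
    qubitTensor F * qubitTensor G = qubitTensor (F * G) := by
  ext a b
  simp only [qubitTensor, Matrix.mul_apply, Matrix.of_apply, Pi.mul_apply,
    ← Finset.prod_mul_distrib, Finset.prod_univ_sum, Fintype.piFinset_univ]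

lemma qubitTensor_one {n : ℕ} :
    qubitTensor (1 : Fin n → Matrix (Fin 2) (Fin 2) ℂ) = 1 := by
  ext a b
  simp only [qubitTensor, Matrix.of_apply, Pi.one_apply, Matrix.one_apply, Finset.prod_ite_zero,
    Finset.prod_const_one, Finset.mem_univ, true_implies, funext_iff]

lemma onQubit_eq_qubitTensor {n : ℕ} (M : Matrix (Fin 2) (Fin 2) ℂ) (i : Fin n) :
    onQubit M i = qubitTensor (Pi.mulSingle i M) := by
  ext a b
  simp only [onQubit, qubitTensor, Matrix.of_apply]
  refine Finset.prod_congr rfl fun s _ => ?_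
  rcases eq_or_ne s i with rfl | h
  · simp
  · simp [h, Matrix.one_apply]

lemma onQubit_mul_onQubit {n : ℕ} (M N : Matrix (Fin 2) (Fin 2) ℂ) (i : Fin n) :
    onQubit M i * onQubit N i = onQubit (M * N) i := by
  simp only [onQubit_eq_qubitTensor, qubitTensor_mul, Pi.mulSingle_mul]

lemma onQubit_one {n : ℕ} (i : Fin n) : onQubit 1 i = 1 := by
  rw [onQubit_eq_qubitTensor, Pi.mulSingle_one, qubitTensor_one]

lemma onQubit_commute {n : ℕ} (M N : Matrix (Fin 2) (Fin 2) ℂ) {i j : Fin n} (h : i ≠ j) :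
    Commute (onQubit M i) (onQubit N j) := by
  simp only [Commute, SemiconjBy, onQubit_eq_qubitTensor, qubitTensor_mul]
  exact congrArg qubitTensor
    (Pi.mulSingle_commute (f := fun _ => Matrix (Fin 2) (Fin 2) ℂ) h M N).eq

lemma onQubit_neg {n : ℕ} (M : Matrix (Fin 2) (Fin 2) ℂ) (i : Fin n) :
    onQubit (-M) i = -onQubit M i := by
  ext a b
  simp [onQubit, ← Finset.mul_prod_erase Finset.univ _ (Finset.mem_univ i)]
  left
  refine Finset.prod_congr rfl fun s hs => ?_
  simp [Finset.ne_of_mem_erase hs]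

lemma onQubit_isHermitian {n : ℕ} {M : Matrix (Fin 2) (Fin 2) ℂ} (hM : M.IsHermitian)
    (i : Fin n) : (onQubit M i).IsHermitian := by
  ext a b
  simp only [onQubit, Matrix.conjTranspose_apply, Matrix.of_apply, star_prod]
  refine Finset.prod_congr rfl fun s _ => ?_
  rw [apply_ite star, hM.apply, apply_ite star, star_one, star_zero]
  simp only [eq_comm]

lemma XY_isHermitian (k : Fin 2) : (XY k).IsHermitian := by
  ext i j
  fin_cases k <;> fin_cases i <;> fin_cases j <;> simp [XY, pX, pY]

lemma XY_mul_self (k : Fin 2) : XY k * XY k = 1 := by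
  ext i j
  fin_cases k <;> fin_cases i <;> fin_cases j <;> simp [XY, pX, pY]

lemma XY_mul_of_ne {k l : Fin 2} (h : k ≠ l) : XY k * XY l = -(XY l * XY k) := by
  ext i j
  fin_cases k <;> fin_cases l <;> first | exact absurd rfl h | skip
  all_goals fin_cases i <;> fin_cases j <;> simp [XY, pX, pY]

lemma onQubit_XY_mul_self {n : ℕ} (k : Fin 2) (i : Fin n) :
    onQubit (XY k) i * onQubit (XY k) i = 1 := by
  rw [onQubit_mul_onQubit, XY_mul_self, onQubit_one]

lemma onQubit_XY_mul_of_ne {n : ℕ} {k l : Fin 2} (h : k ≠ l) (i : Fin n) :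
    onQubit (XY k) i * onQubit (XY l) i = -(onQubit (XY l) i * onQubit (XY k) i) := by
  rw [onQubit_mul_onQubit, XY_mul_of_ne h, onQubit_neg, onQubit_mul_onQubit]

/-- Pairwise anticommuting Hermitian involutions have expectation values whose squares sum to at
most one. -/
lemma sum_sq_expectation_le_one {m ι : Type*} [Fintype m] [DecidableEq m] [Fintype ι]
    {ρ : Matrix m m ℂ} (hρ : ρ.PosSemidef) (htr : ρ.trace = 1)
    (A : ι → Matrix m m ℂ) (hA : ∀ i, (A i).IsHermitian) (hsq : ∀ i, A i * A i = 1)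
    (hanti : ∀ i j, i ≠ j → A i * A j = -(A j * A i)) :
    ∑ i, (ρ * A i).trace.re ^ 2 ≤ 1 := by
  classical
  set t : ι → ℝ := fun i => (ρ * A i).trace.re with ht
  set s : ℝ := ∑ i, t i ^ 2 with hs
  set B : Matrix m m ℂ := ∑ i, (t i : ℂ) • A i with hB
  have hBH : Bᴴ = B := by
    simp [hB, Matrix.conjTranspose_sum, Matrix.conjTranspose_smul, (hA _).eq]
  have hBB : B * B + B * B = ((2 * s : ℝ) : ℂ) • (1 : Matrix m m ℂ) := by
    have hexp : B * B = ∑ i, ∑ j, ((t i * t j : ℝ) : ℂ) • (A i * A j) := by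
      simp only [hB, Finset.sum_mul_sum, Matrix.smul_mul, Matrix.mul_smul, smul_smul,
        Complex.ofReal_mul]
      exact Finset.sum_congr rfl fun i _ => Finset.sum_congr rfl fun j _ => by
        rw [mul_comm (t j : ℂ)]
    have hexp' : B * B = ∑ i, ∑ j, ((t i * t j : ℝ) : ℂ) • (A j * A i) := by
      rw [hexp, Finset.sum_comm]
      simp only [mul_comm]
    nth_rewrite 1 [hexp]
    rw [hexp']
    simp only [← Finset.sum_add_distrib, ← smul_add]
    have key : ∀ i j, A i * A j + A j * A i = if i = j then (2 : ℂ) • (1 : Matrix m m ℂ) else 0 := by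
      intro i j
      split_ifs with h
      · rw [h, hsq, two_smul]
      · rw [hanti i j h, neg_add_cancel]
    simp only [key, smul_ite, smul_zero, Finset.sum_ite_eq, Finset.mem_univ, if_true, smul_smul,
      ← Finset.sum_smul]
    congr 1
    push_cast [hs]
    rw [Finset.mul_sum]
    exact Finset.sum_congr rfl fun i _ => by ring
  have hρB : (ρ * B).trace.re = s := by
    simp [hB, Finset.mul_sum, Matrix.trace_sum, hs, ht, sq]
  have hρBB : (ρ * (B * B)).trace.re = s := by
    have := congrArg (fun M => (ρ * M).trace.re) hBB
    simp [Matrix.mul_add, htr] at this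
    linarith
  have hpos := (hρ.mul_mul_conjTranspose_same (1 - B)).trace_nonneg
  rw [Matrix.trace_mul_comm, ← Matrix.mul_assoc, Matrix.trace_mul_comm, Matrix.conjTranspose_sub,
    Matrix.conjTranspose_one, hBH] at hpos
  have hre := (Complex.le_def.1 hpos).1
  simp only [Matrix.mul_sub, Matrix.sub_mul, Matrix.mul_one, Matrix.one_mul, Matrix.trace_sub,
    Complex.sub_re, hρB, hρBB, htr, Complex.zero_re, Complex.one_re] at hre
  linarith

lemma sum_sq_shared_qubit_le_one {n : ℕ} {ρ : Matrix (Fin n → Fin 2) (Fin n → Fin 2) ℂ}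
    (hρ : IsDensityMatrix ρ) (u : Fin n) (f : Fin 2 → Fin n) (hf : f.Injective)
    (hu : ∀ k, u ≠ f k) :
    ∑ k, ∑ l, ((ρ * (onQubit (XY k) u * onQubit (XY l) (f k))).trace.re) ^ 2 ≤ 1 := by
  rw [← Fintype.sum_prod_type']
  have hcomm (k k' l : Fin 2) := (onQubit_commute (XY k') (XY l) (hu k)).eq
  refine sum_sq_expectation_le_one hρ.1 hρ.2
    (fun p : Fin 2 × Fin 2 => onQubit (XY p.1) u * onQubit (XY p.2) (f p.1)) ?_ ?_ ?_
  · rintro ⟨k, l⟩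
    rw [Matrix.IsHermitian, Matrix.conjTranspose_mul, (onQubit_isHermitian (XY_isHermitian _) _).eq,
      (onQubit_isHermitian (XY_isHermitian _) _).eq, hcomm]
  · rintro ⟨k, l⟩
    rw [(onQubit_commute (XY k) (XY l) (hu k)).symm.mul_mul_mul_comm, onQubit_XY_mul_self,
      onQubit_XY_mul_self, one_mul]
  · rintro ⟨k, l⟩ ⟨k', l'⟩ h
    dsimp only
    rw [(onQubit_commute (XY k') (XY l) (hu k)).symm.mul_mul_mul_comm,
      (onQubit_commute (XY k) (XY l') (hu k')).symm.mul_mul_mul_comm]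
    rcases eq_or_ne k k' with rfl | hk
    · rw [onQubit_XY_mul_of_ne (fun hl => h (by rw [hl])) (f k), mul_neg]
    · rw [onQubit_XY_mul_of_ne hk, (onQubit_commute _ _ (hf.ne hk)).eq, neg_mul]

lemma T2pair_comm {n : ℕ} (ρ : Matrix (Fin n → Fin 2) (Fin n → Fin 2) ℂ) {i j : Fin n}
    (h : i ≠ j) : T2pair ρ i j = T2pair ρ j i := by
  rw [T2pair, Finset.sum_comm]
  exact Finset.sum_congr rfl fun l _ => Finset.sum_congr rfl fun k _ => by
    rw [(onQubit_commute (XY k) (XY l) h).eq]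

/-- Bell monogamy for two pairs sharing a qubit. -/
lemma T2pair_add_T2pair_le_two {n : ℕ} {ρ : Matrix (Fin n → Fin 2) (Fin n → Fin 2) ℂ}
    (hρ : IsDensityMatrix ρ) {u v w : Fin n} (huv : u ≠ v) (huw : u ≠ w) (hvw : v ≠ w) :
    T2pair ρ u v + T2pair ρ u w ≤ 2 := by
  have inj {a b : Fin n} (h : a ≠ b) : Function.Injective ![a, b] := by
    simpa [Function.Injective, Fin.forall_fin_two, h] using h.symm
  have h1 := sum_sq_shared_qubit_le_one hρ u ![v, w] (inj hvw)
    (by simp [Fin.forall_fin_two, huv, huw])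
  have h2 := sum_sq_shared_qubit_le_one hρ u ![w, v] (inj hvw.symm)
    (by simp [Fin.forall_fin_two, huv, huw])
  simp only [T2pair, Fin.sum_univ_two, Matrix.cons_val_zero, Matrix.cons_val_one] at h1 h2 ⊢
  linarith

lemma SimpleGraph.sum_edgeFinset_eq_sum_neighborFinset {V M : Type*} [Fintype V] [LinearOrder V]
    [AddCommMonoid M] (G : SimpleGraph V) [DecidableRel G.Adj] (g : V → V → M) :
    ∑ e ∈ G.edgeFinset, (g e.inf e.sup + g e.sup e.inf) =
      ∑ v, ∑ u ∈ G.neighborFinset v, g v u := by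
  have hdart : ∑ d : G.Dart, g d.fst d.snd = ∑ v, ∑ u ∈ G.neighborFinset v, g v u := by
    rw [← Finset.sum_fiberwise Finset.univ (fun d : G.Dart => d.fst)]
    refine Finset.sum_congr rfl fun v _ => ?_
    rw [G.dart_fst_fiber, Finset.sum_image fun _ _ _ _ h => G.dartOfNeighborSet_injective v h]
    exact (Finset.sum_subtype _ (fun u => by simp) (g v)).symm
  rw [← hdart, ← Finset.sum_fiberwise_of_maps_to (s := Finset.univ) (t := G.edgeFinset)
    (g := fun d : G.Dart => d.edge) (fun d _ => by simp)]
  refine Finset.sum_congr rfl fun e he => ?_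
  induction e with | _ a b
  have hab : G.Adj a b := by simpa using he
  have hfib := SimpleGraph.Dart.edge_fiber (⟨(a, b), hab⟩ : G.Dart)
  rw [SimpleGraph.Dart.edge_mk] at hfib
  rw [hfib, Finset.sum_pair (SimpleGraph.Dart.symm_ne _).symm]
  rcases le_total a b with h | h
  · simp [h]
  · simp [h, add_comm]

/-- If any two distinct values sum to at most `2`, then the values average to at most `1`. -/
lemma Finset.card_sub_one_mul_sum_le {α : Type*} (S : Finset α) (f : α → ℝ)
    (hf : ∀ u ∈ S, ∀ w ∈ S, u ≠ w → f u + f w ≤ 2) :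
    ((S.card : ℝ) - 1) * ∑ u ∈ S, f u ≤ S.card * (S.card - 1) := by
  classical
  have hcard {u : α} (hu : u ∈ S) : ((S.erase u).card : ℝ) = S.card - 1 := by
    rw [Finset.card_erase_of_mem hu, Nat.cast_pred (Finset.card_pos.2 ⟨u, hu⟩)]
  have h : ∑ u ∈ S, ∑ w ∈ S.erase u, (f u + f w) ≤ ∑ u ∈ S, ∑ w ∈ S.erase u, (2 : ℝ) :=
    Finset.sum_le_sum fun u hu => Finset.sum_le_sum fun w hw =>
      hf u hu w (Finset.mem_of_mem_erase hw) (Finset.ne_of_mem_erase hw).symm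
  have hl : ∑ u ∈ S, ∑ w ∈ S.erase u, (f u + f w) = 2 * (((S.card : ℝ) - 1) * ∑ u ∈ S, f u) := by
    have : ∀ u ∈ S, ∑ w ∈ S.erase u, (f u + f w) =
        ((S.card : ℝ) - 2) * f u + ∑ w ∈ S, f w := fun u hu => by
      rw [Finset.sum_add_distrib, Finset.sum_const, nsmul_eq_mul, hcard hu,
        Finset.sum_erase_eq_sub hu]
      ring
    rw [Finset.sum_congr rfl this, Finset.sum_add_distrib, ← Finset.mul_sum, Finset.sum_const,
      nsmul_eq_mul]
    ring
  have hr : ∑ u ∈ S, ∑ w ∈ S.erase u, (2 : ℝ) = 2 * (S.card * (S.card - 1)) := by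
    have : ∀ u ∈ S, ∑ w ∈ S.erase u, (2 : ℝ) = (S.card - 1) * 2 := fun u hu => by
      rw [Finset.sum_const, nsmul_eq_mul, hcard hu]
    rw [Finset.sum_congr rfl this, Finset.sum_const, nsmul_eq_mul]
    ring
  linarith

/-- **General bipartite Bell monogamy for arbitrary graphs.** For a finite simple graph `G`
on the qubits, summing the Bell strength of each edge weighted by the degree of that edge in
the line graph of `G` is bounded by twice the number of edges of the line graph. -/
theorem general_bipartite_monogamy {n : ℕ} (G : SimpleGraph (Fin n)) [DecidableRel G.Adj]
    (ρ : Matrix (Fin n → Fin 2) (Fin n → Fin 2) ℂ) (hρ : IsDensityMatrix ρ) :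
    ∑ e ∈ G.edgeFinset,
        ((G.degree e.inf + G.degree e.sup : ℝ) - 2) * T2pair ρ e.inf e.sup
      ≤ 2 * ∑ v : Fin n, ((G.degree v).choose 2 : ℝ) := by
  set g : Fin n → Fin n → ℝ := fun v u => ((G.degree v : ℝ) - 1) * T2pair ρ v u with hg
  have hedge : ∀ e ∈ G.edgeFinset,
      ((G.degree e.inf + G.degree e.sup : ℝ) - 2) * T2pair ρ e.inf e.sup =
        g e.inf e.sup + g e.sup e.inf := by
    intro e he
    have hne : e.inf ≠ e.sup := by
      induction e with | _ a b
      simpa using G.ne_of_adj (by simpa using he)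
    simp only [hg, T2pair_comm ρ hne.symm]
    ring
  rw [Finset.sum_congr rfl hedge, G.sum_edgeFinset_eq_sum_neighborFinset, Finset.mul_sum]
  refine Finset.sum_le_sum fun v _ => ?_
  have hv := Finset.card_sub_one_mul_sum_le (G.neighborFinset v) (T2pair ρ v)
    fun u hu w hw huw => T2pair_add_T2pair_le_two hρ
      (G.ne_of_adj (by simpa using hu)) (G.ne_of_adj (by simpa using hw)) huw
  rw [G.card_neighborFinset_eq_degree] at hv
  rw [← Finset.mul_sum, Nat.cast_choose_two]
  linarith
end
end
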